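/- Let G be a finite simple graph with minimum degree at least 4, and let S be a good independent set of G all of whose vertices have degree at most 9 in G, such that φ(S) ⪰ φ(S') for every good independent set S' of G all of whose vertices have degree at most 9. Then every vertex v ∈ V(G) − (S ∪ N_G(S)) with deg_G(v) ≤ 9 has at least three neighbours in N_G(S); consequently, every vertex of V(G) − (S ∪ N_G(S)) having at most two neighbours in N_G(S) has degree at least 10 in G. -/

import Mathlib

open SimpleGraph

variable {V : Type*}

/-- `Gv G v` is the subgraph of `G` induced by `{v} ∪ N_G(v)`. -/
def Gv (G : SimpleGraph V) (v : V) : G.Subgraph :=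
  (⊤ : G.Subgraph).induce ({v} ∪ G.neighborSet v)

/-- Two subgraphs of `G` are compatible if they have at most two vertices in common. -/
def Compatible (G : SimpleGraph V) (H₁ H₂ : G.Subgraph) : Prop :=
  (H₁.verts ∩ H₂.verts).ncard ≤ 2

/-- Binary trees whose leaves are labelled by vertices. -/
inductive RepTree (V : Type*) where
  | leaf : V → RepTree V
  | node : RepTree V → RepTree V → RepTree V

namespace RepTree

/-- The list of (labels of) leaves of a binary tree. -/
def leaves : RepTree V → List V
  | leaf v => [v]
  | node a b => leaves a ++ leaves b

/-- The subgraph `G⟨x⟩` associated with a node `x`, given the assignment `f` of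
subgraphs to leaves: the union of the subgraphs at the leaves below `x`. -/
def graphOf (G : SimpleGraph V) (f : V → G.Subgraph) : RepTree V → G.Subgraph
  | leaf v => f v
  | node a b => graphOf G f a ⊔ graphOf G f b

/-- The tree, with subgraphs assigned to its leaves by `f`, is a tree
representation in `G`: the subgraphs `G⟨a⟩` and `G⟨b⟩` are compatible whenever
`a` and `b` are children of a common node. -/
def IsRep (G : SimpleGraph V) (f : V → G.Subgraph) : RepTree V → Prop
  | leaf _ => True
  | node a b => IsRep G f a ∧ IsRep G f b ∧ Compatible G (graphOf G f a) (graphOf G f b)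

/-- `IsNode x T` means that `x` is (the subtree rooted at) a node of `T`. -/
inductive IsNode : RepTree V → RepTree V → Prop
  | refl (t : RepTree V) : IsNode t t
  | left {x a b : RepTree V} : IsNode x a → IsNode x (node a b)
  | right {x a b : RepTree V} : IsNode x b → IsNode x (node a b)

end RepTree

variable [Fintype V] [DecidableEq V]

/-- `Ŝ_i = S_4 ∪ ⋯ ∪ S_i`, the set of vertices of `S` whose degree lies in `[4, i]`. -/
def Shat (G : SimpleGraph V) [DecidableRel G.Adj] (S : Finset V) (i : ℕ) : Finset V :=
  S.filter fun v => 4 ≤ G.degree v ∧ G.degree v ≤ i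

/-- `H_i := ⋃_{v ∈ Ŝ_i} G_v`. -/
def Hsub (G : SimpleGraph V) [DecidableRel G.Adj] (S : Finset V) (i : ℕ) : G.Subgraph :=
  ⨆ v ∈ Shat G S i, Gv G v

/-- `C` is a connected component of `H`: a maximal connected subgraph of `H`. -/
def IsComponent (G : SimpleGraph V) (H C : G.Subgraph) : Prop :=
  C.Connected ∧ C ≤ H ∧ ∀ D : G.Subgraph, C ≤ D → D ≤ H → D.Connected → D = C

/-- `S` is good: there is a tree representation `(T, {G_u : u ∈ S})` respecting `S`
such that for every `i ∈ [4,9]` and every connected component `X` of `H_i` there is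
a node `x` of `T` with `X = G⟨x⟩`. -/
def IsGood (G : SimpleGraph V) [DecidableRel G.Adj] (S : Finset V) : Prop :=
  ∃ T : RepTree V, T.leaves.Nodup ∧ T.leaves.toFinset = S ∧
    RepTree.IsRep G (Gv G) T ∧
    ∀ i : ℕ, 4 ≤ i → i ≤ 9 → ∀ X : G.Subgraph, IsComponent G (Hsub G S i) X →
      ∃ x : RepTree V, RepTree.IsNode x T ∧ RepTree.graphOf G (Gv G) x = X

/-- `φ(S) = (|S_4|, |S_5|, …, |S_9|)`. -/
def phi (G : SimpleGraph V) [DecidableRel G.Adj] (S : Finset V) : Fin 6 → ℕ :=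
  fun k => (S.filter fun v => G.degree v = k.1 + 4).card

/-- Strict lexicographic order on the vectors `φ(S)`. -/
def PhiGT (a b : Fin 6 → ℕ) : Prop :=
  ∃ j : Fin 6, (∀ k : Fin 6, k < j → a k = b k) ∧ b j < a j

/-- `⪰` : strict lexicographic order or equality. -/
def PhiGE (a b : Fin 6 → ℕ) : Prop := PhiGT a b ∨ a = b

namespace SimpleGraph.Subgraph

/-- A component of the union of pairwise disjoint connected subgraphs is one of them. -/
theorem mem_of_isComponent_sSup {V : Type*} {G : SimpleGraph V} {F : Set G.Subgraph}
    (hconn : ∀ A ∈ F, A.Connected)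
    (hdisj : ∀ A ∈ F, ∀ B ∈ F, ∀ w, w ∈ A.verts → w ∈ B.verts → A = B)
    {X : G.Subgraph} (hX : IsComponent G (sSup F) X) : X ∈ F := by
  obtain ⟨hXc, hXle, hXmax⟩ := hX
  obtain ⟨w, hw⟩ := hXc.nonempty
  obtain ⟨A, hA, hwA⟩ : ∃ A ∈ F, w ∈ A.verts := by
    simpa using hXle.1 hw
  have step : ∀ a b, a ∈ A.verts → X.Adj a b → A.Adj a b := by
    intro a b ha hab
    obtain ⟨B, hB, hBab⟩ := sSup_adj.1 (hXle.2 hab)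
    rwa [hdisj A hA B hB a ha hBab.fst_mem]
  have hverts : ∀ z ∈ X.verts, z ∈ A.verts := by
    intro z hz
    obtain ⟨p⟩ := hXc.preconnected ⟨w, hw⟩ ⟨z, hz⟩
    have key : ∀ (a b : X.verts), X.coe.Walk a b → (a : V) ∈ A.verts → (b : V) ∈ A.verts := by
      intro a b p
      induction p with
      | nil => exact id
      | cons h _ ih => exact fun ha => ih (step _ _ ha h).snd_mem
    exact key _ _ p hwA
  have hle : X ≤ A := ⟨hverts, fun a b hab => step a b (hverts a hab.fst_mem) hab⟩
  rwa [← hXmax A hle (le_sSup hA) (hconn A hA)]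

theorem exists_isComponent_ge {V : Type*} [Finite V] {G : SimpleGraph V} {H C : G.Subgraph}
    (hC : C.Connected) (hle : C ≤ H) : ∃ X, IsComponent G H X ∧ C ≤ X := by
  obtain ⟨X, hCX, hX⟩ := (Set.toFinite {D : G.Subgraph | D ≤ H ∧ D.Connected}).exists_le_maximal
    (show C ∈ {D : G.Subgraph | D ≤ H ∧ D.Connected} from ⟨hle, hC⟩)
  exact ⟨X, ⟨hX.prop.2, hX.prop.1, fun D hXD hD hDc => (hX.eq_of_le ⟨hD, hDc⟩ hXD).symm⟩, hCX⟩

end SimpleGraph.Subgraph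

theorem IsComponent.eq_of_mem {V : Type*} {G : SimpleGraph V} {H X Y : G.Subgraph}
    (hX : IsComponent G H X) (hY : IsComponent G H Y) {w : V}
    (hwX : w ∈ X.verts) (hwY : w ∈ Y.verts) : X = Y := by
  have hsup : (X ⊔ Y).Connected :=
    Subgraph.connected_sup hX.1.preconnected hY.1.preconnected ⟨w, hwX, hwY⟩
  have hle : X ⊔ Y ≤ H := sup_le hX.2.1 hY.2.1
  rw [← hX.2.2 _ le_sup_left hle hsup, hY.2.2 _ le_sup_right hle hsup]

theorem mem_verts_Gv {V : Type*} {G : SimpleGraph V} {v w : V} :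
    w ∈ (Gv G v).verts ↔ w = v ∨ G.Adj v w := by
  simp [Gv]

theorem connected_Gv {V : Type*} (G : SimpleGraph V) (v : V) : (Gv G v).Connected := by
  have hv : v ∈ (Gv G v).verts := mem_verts_Gv.2 (.inl rfl)
  have key : ∀ w : (Gv G v).verts, (Gv G v).coe.Reachable ⟨v, hv⟩ w := by
    rintro ⟨w, hw⟩
    rcases mem_verts_Gv.1 hw with rfl | h
    · exact .refl _
    · refine Adj.reachable ?_
      simp [Gv, h]
  exact Subgraph.connected_iff.2 ⟨⟨fun a b => (key a).symm.trans (key b)⟩, v, hv⟩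

namespace RepTree

variable {U : Type*} {G : SimpleGraph U} {f : U → G.Subgraph}

theorem graphOf_eq_iSup (t : RepTree U) : graphOf G f t = ⨆ u ∈ t.leaves, f u := by
  induction t with
  | leaf v => simp [graphOf, leaves]
  | node a b iha ihb => simp [graphOf, leaves, iha, ihb, iSup_or, iSup_sup_eq]

theorem le_graphOf {t : RepTree U} {u : U} (hu : u ∈ t.leaves) : f u ≤ graphOf G f t := by
  rw [graphOf_eq_iSup]
  exact le_iSup₂_of_le u hu le_rfl

theorem mem_verts_graphOf {t : RepTree U} {w : U} :
    w ∈ (graphOf G f t).verts ↔ ∃ u ∈ t.leaves, w ∈ (f u).verts := by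
  simp [graphOf_eq_iSup]

theorem exists_mem_leaves (t : RepTree U) : ∃ u, u ∈ t.leaves := by
  induction t with
  | leaf v => exact ⟨v, by simp [leaves]⟩
  | node a b iha _ => exact iha.imp fun u hu => by simp [leaves, hu]

theorem IsNode.leaves_sublist {x t : RepTree U} (h : IsNode x t) : x.leaves.Sublist t.leaves := by
  induction h with
  | refl => exact .refl _
  | left _ ih => exact ih.trans (List.sublist_append_left _ _)
  | right _ ih => exact ih.trans (List.sublist_append_right _ _)

theorem IsNode.isRep {x t : RepTree U} (h : IsNode x t) (ht : IsRep G f t) : IsRep G f x := by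
  induction h with
  | refl => exact ht
  | left _ ih => exact ih ht.1
  | right _ ih => exact ih ht.2.1

theorem IsNode.graphOf_le {x t : RepTree U} (h : IsNode x t) : graphOf G f x ≤ graphOf G f t := by
  induction h with
  | refl => exact le_rfl
  | left _ ih => exact ih.trans le_sup_left
  | right _ ih => exact ih.trans le_sup_right

/-- Two nodes of a tree with distinct leaves that share a leaf are comparable. -/
theorem IsNode.comparable {x y t : RepTree U} (ht : t.leaves.Nodup) (hx : IsNode x t)
    (hy : IsNode y t) {u : U} (hux : u ∈ x.leaves) (huy : u ∈ y.leaves) :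
    IsNode x y ∨ IsNode y x := by
  induction t with
  | leaf v => cases hx; exact .inr hy
  | node a b iha ihb =>
    obtain ⟨ha, hb, hab⟩ := List.nodup_append.1 ht
    cases hx with
    | refl => exact .inr hy
    | left hx =>
      cases hy with
      | refl => exact .inl (.left hx)
      | left hy => exact iha ha hx hy
      | right hy =>
        exact absurd rfl (hab u (hx.leaves_sublist.subset hux) u (hy.leaves_sublist.subset huy))
    | right hx =>
      cases hy with
      | refl => exact .inl (.right hx)
      | left hy =>
        exact absurd rfl (hab u (hy.leaves_sublist.subset huy) u (hx.leaves_sublist.subset hux))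
      | right hy => exact ihb hb hx hy

theorem IsNode.trans {x y z : RepTree U} (hxy : IsNode x y) (hyz : IsNode y z) : IsNode x z := by
  induction hyz with
  | refl => exact hxy
  | left _ ih => exact .left ih
  | right _ ih => exact .right ih

/-- The caterpillar obtained from `t` by successively joining the trees in a list. -/
def attach (L : List (RepTree U)) (t : RepTree U) : RepTree U :=
  L.foldr node t

theorem isNode_attach (L : List (RepTree U)) (t : RepTree U) : IsNode t (attach L t) := by
  induction L with
  | nil => exact .refl t
  | cons x L ih => exact .right ih

theorem isNode_attach_of_mem {L : List (RepTree U)} {x : RepTree U} (t : RepTree U) (hx : x ∈ L) :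
    IsNode x (attach L t) := by
  induction L with
  | nil => simp at hx
  | cons y L ih =>
    rcases List.mem_cons.1 hx with rfl | hx
    · exact .left (.refl _)
    · exact .right (ih hx)

theorem mem_leaves_attach {L : List (RepTree U)} {t : RepTree U} {u : U} :
    u ∈ (attach L t).leaves ↔ u ∈ t.leaves ∨ ∃ x ∈ L, u ∈ x.leaves := by
  induction L with
  | nil => simp [attach]
  | cons x L ih =>
    change u ∈ x.leaves ++ (attach L t).leaves ↔ _
    rw [List.mem_append, ih]
    grind

theorem mem_verts_graphOf_attach {L : List (RepTree U)} {t : RepTree U} {w : U} :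
    w ∈ (graphOf G f (attach L t)).verts ↔
      w ∈ (graphOf G f t).verts ∨ ∃ x ∈ L, w ∈ (graphOf G f x).verts := by
  simp only [mem_verts_graphOf, mem_leaves_attach]
  grind

theorem nodup_leaves_attach {L : List (RepTree U)} {t : RepTree U} (ht : t.leaves.Nodup)
    (hL : ∀ x ∈ L, x.leaves.Nodup) (htL : ∀ x ∈ L, x.leaves.Disjoint t.leaves)
    (hLL : L.Pairwise fun x y => x.leaves.Disjoint y.leaves) : (attach L t).leaves.Nodup := by
  induction L with
  | nil => exact ht
  | cons x L ih =>
    rw [List.pairwise_cons] at hLL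
    simp only [List.forall_mem_cons] at hL htL
    refine List.Nodup.append hL.1 (ih hL.2 htL.2 hLL.2) fun u hux hu => ?_
    rcases mem_leaves_attach.1 hu with hu | ⟨y, hy, hu⟩
    · exact htL.1 hux hu
    · exact hLL.1 y hy hux hu

theorem isRep_attach {L : List (RepTree U)} {t : RepTree U} (ht : IsRep G f t)
    (hL : ∀ x ∈ L, IsRep G f x) (htL : ∀ x ∈ L, Compatible G (graphOf G f x) (graphOf G f t))
    (hLL : L.Pairwise fun x y => Disjoint (graphOf G f x).verts (graphOf G f y).verts) :
    IsRep G f (attach L t) := by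
  induction L with
  | nil => exact ht
  | cons x L ih =>
    rw [List.pairwise_cons] at hLL
    simp only [List.forall_mem_cons] at hL htL
    refine ⟨hL.1, ih hL.2 htL.2 hLL.2, ?_⟩
    have hinter : (graphOf G f x).verts ∩ (graphOf G f (attach L t)).verts =
        (graphOf G f x).verts ∩ (graphOf G f t).verts := by
      ext w
      refine and_congr_right fun hwx => ?_
      rw [mem_verts_graphOf_attach, or_iff_left]
      rintro ⟨y, hy, hwy⟩
      exact Set.disjoint_left.1 (hLL.1 y hy) hwx hwy
    exact (congrArg Set.ncard hinter).trans_le htL.1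

theorem connected_graphOf_attach {L : List (RepTree U)} {t : RepTree U}
    (ht : (graphOf G f t).Connected) (hL : ∀ x ∈ L, (graphOf G f x).Connected)
    (hLt : ∀ x ∈ L, ((graphOf G f x).verts ∩ (graphOf G f t).verts).Nonempty) :
    (graphOf G f (attach L t)).Connected := by
  induction L with
  | nil => exact ht
  | cons x L ih =>
    simp only [List.forall_mem_cons] at hL hLt
    obtain ⟨w, hwx, hwt⟩ := hLt.1
    exact Subgraph.connected_sup hL.1.preconnected (ih hL.2 hLt.2).preconnected
      ⟨w, hwx, (isNode_attach L t).graphOf_le.1 hwt⟩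

end RepTree

theorem Gv_le_Hsub {V : Type*} [Fintype V] {G : SimpleGraph V} [DecidableRel G.Adj] {S : Finset V}
    {i : ℕ} {u : V} (hu : u ∈ Shat G S i) : Gv G u ≤ Hsub G S i :=
  le_iSup₂_of_le (f := fun v (_ : v ∈ Shat G S i) => Gv G v) u hu le_rfl

theorem mem_verts_Hsub {V : Type*} [Fintype V] {G : SimpleGraph V} [DecidableRel G.Adj]
    {S : Finset V} {i : ℕ} {w : V} :
    w ∈ (Hsub G S i).verts ↔ ∃ u ∈ Shat G S i, w ∈ (Gv G u).verts := by
  simp [Hsub]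

theorem mem_Shat {V : Type*} [Fintype V] {G : SimpleGraph V} [DecidableRel G.Adj]
    {S : Finset V} {i : ℕ} {u : V} :
    u ∈ Shat G S i ↔ u ∈ S ∧ 4 ≤ G.degree u ∧ G.degree u ≤ i := by
  simp [Shat]

theorem Hsub_mono {V : Type*} [Fintype V] {G : SimpleGraph V} [DecidableRel G.Adj]
    {S : Finset V} {i j : ℕ}
    (hij : i ≤ j) : Hsub G S i ≤ Hsub G S j := by
  refine iSup₂_le fun u hu => Gv_le_Hsub ?_
  rw [mem_Shat] at hu ⊢
  exact ⟨hu.1, hu.2.1, hu.2.2.trans hij⟩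

theorem Shat_insert_Shat_of_lt {G : SimpleGraph V} [DecidableRel G.Adj] {S : Finset V} {i : ℕ}
    {v : V} (hi : i < G.degree v) : Shat G (insert v (Shat G S (G.degree v))) i = Shat G S i := by
  ext u
  simp only [mem_Shat, Finset.mem_insert]
  constructor
  · rintro ⟨rfl | h, h4, hui⟩
    · omega
    · exact ⟨h.1, h4, hui⟩
  · rintro ⟨h, h4, hui⟩
    exact ⟨.inr ⟨h, h4, hui.trans hi.le⟩, h4, hui⟩

theorem Shat_insert_Shat_of_le {G : SimpleGraph V} [DecidableRel G.Adj] {S : Finset V} {i : ℕ}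
    {v : V} (hv : 4 ≤ G.degree v) (hi : G.degree v ≤ i) :
    Shat G (insert v (Shat G S (G.degree v))) i = insert v (Shat G S (G.degree v)) := by
  refine Finset.filter_true_of_mem fun u hu => ?_
  rcases Finset.mem_insert.1 hu with rfl | hu
  · exact ⟨hv, hi⟩
  · exact ⟨(mem_Shat.1 hu).2.1, (mem_Shat.1 hu).2.2.trans hi⟩

theorem phi_insert_Shat {G : SimpleGraph V} [DecidableRel G.Adj] {S : Finset V} {v : V}
    (hvS : v ∉ S) (hv4 : 4 ≤ G.degree v) (hv9 : G.degree v ≤ 9) :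
    PhiGT (phi G (insert v (Shat G S (G.degree v)))) (phi G S) := by
  refine ⟨⟨G.degree v - 4, by omega⟩, fun k hk => ?_, ?_⟩
  · have hk : k.1 < G.degree v - 4 := hk
    refine congrArg Finset.card ?_
    ext u
    simp only [Finset.mem_filter, Finset.mem_insert, mem_Shat]
    constructor
    · rintro ⟨rfl | h, hu⟩
      · omega
      · exact ⟨h.1, hu⟩
    · rintro ⟨h, hu⟩
      exact ⟨.inr ⟨h, by omega, by omega⟩, hu⟩
  · refine Finset.card_lt_card (Finset.ssubset_iff.2 ⟨v, by simp [hvS], fun u hu => ?_⟩)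
    simp only [Finset.mem_filter, Finset.mem_insert, mem_Shat] at hu ⊢
    rcases hu with rfl | ⟨h, hu⟩
    · exact ⟨.inl rfl, by omega⟩
    · exact ⟨.inr ⟨h, by omega, by omega⟩, hu⟩

theorem PhiGT.not_phiGE {a b : Fin 6 → ℕ} (h : PhiGT b a) : ¬ PhiGE a b := by
  obtain ⟨j, hj, hlt⟩ := h
  rintro (⟨k, hk, hlt'⟩ | rfl)
  · rcases lt_trichotomy j k with h | rfl | h
    · exact hlt.ne (hk j h)
    · omega
    · exact hlt'.ne (hj k h)
  · exact hlt.false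

/-- In an independent set, a member of `S` lies in `G_u` with `u ∈ S` only if it is `u`. -/
theorem eq_of_mem_verts_Gv {V : Type*} {G : SimpleGraph V} {S : Finset V}
    (hindep : ∀ u ∈ S, ∀ w ∈ S, ¬ G.Adj u w) {u w : V} (hu : u ∈ S) (hw : w ∈ S)
    (h : w ∈ (Gv G u).verts) : w = u :=
  (mem_verts_Gv.1 h).resolve_right (hindep u hu w hw)

/-- Adding a vertex `v` to the members of a good independent set having degree at most `deg v`
preserves goodness if the union of their closed neighbourhoods shares at most two vertices
with that of `v`. -/
theorem IsGood.insert_Shat {G : SimpleGraph V} [DecidableRel G.Adj] {S : Finset V}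
    (hindep : ∀ u ∈ S, ∀ w ∈ S, ¬ G.Adj u w) (hgood : IsGood G S) {v : V} (hvS : v ∉ S)
    (hv4 : 4 ≤ G.degree v) (hv9 : G.degree v ≤ 9)
    (hcompat : Compatible G (Hsub G S (G.degree v)) (Gv G v)) :
    IsGood G (insert v (Shat G S (G.degree v))) := by
  classical
  obtain ⟨T, hTnd, rfl, hTrep, hTnode⟩ := hgood
  simp only [List.mem_toFinset] at hindep hvS
  set S := T.leaves.toFinset
  have hindep' : ∀ u ∈ S, ∀ w ∈ S, ¬ G.Adj u w := by simpa [S] using hindep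
  set d := G.degree v
  set H := Hsub G S d
  have hf : ∀ X, ∃ x, IsComponent G H X →
      RepTree.IsNode x T ∧ RepTree.graphOf G (Gv G) x = X := by
    intro X
    by_cases hX : IsComponent G H X
    · obtain ⟨x, hx⟩ := hTnode d hv4 hv9 X hX
      exact ⟨x, fun _ => hx⟩
    · exact ⟨T, fun h => absurd h hX⟩
  choose f hf using hf
  have hfS : ∀ X, IsComponent G H X → ∀ u ∈ (f X).leaves, u ∈ S := fun X hX u hu =>
    List.mem_toFinset.2 ((hf X hX).1.leaves_sublist.subset hu)
  have hself : ∀ u, u ∈ (Gv G u).verts := fun u => mem_verts_Gv.2 (.inl rfl)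
  have hle : ∀ X, IsComponent G H X → ∀ u ∈ (f X).leaves, Gv G u ≤ X := fun X hX u hu =>
    (RepTree.le_graphOf hu).trans_eq (hf X hX).2
  -- the leaves below `f X` are the members of `S` lying in `X`
  have hleaf : ∀ X, IsComponent G H X → ∀ u ∈ S, u ∈ X.verts → u ∈ (f X).leaves := by
    intro X hX u hu huX
    rw [← (hf X hX).2, RepTree.mem_verts_graphOf] at huX
    obtain ⟨w, hw, huw⟩ := huX
    rwa [eq_of_mem_verts_Gv hindep' (hfS X hX w hw) hu huw]
  have hShat : ∀ u ∈ S, u ∈ H.verts → u ∈ Shat G S d := by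
    intro u hu huH
    obtain ⟨w, hw, huw⟩ := mem_verts_Hsub.1 huH
    rwa [eq_of_mem_verts_Gv hindep' (mem_Shat.1 hw).1 hu huw]
  let P : G.Subgraph → Prop := fun X => (X.verts ∩ (Gv G v).verts).Nonempty
  let M := (Set.toFinite {X | IsComponent G H X}).toFinset.toList
  have hM : ∀ X, X ∈ M ↔ IsComponent G H X := by simp [M]
  let N₁ := M.filter (fun X => P X)
  let N₂ := M.filter (fun X => ¬ P X)
  have hN₁ : ∀ X, X ∈ N₁ ↔ IsComponent G H X ∧ P X := by simp [N₁, hM]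
  have hN₂ : ∀ X, X ∈ N₂ ↔ IsComponent G H X ∧ ¬ P X := by simp [N₂, hM]
  have hN : ∀ X, X ∈ N₂ ++ N₁ ↔ IsComponent G H X := by
    intro X
    rw [List.mem_append, hN₁, hN₂]
    tauto
  have hNnd : (N₂ ++ N₁).Nodup := by
    have hMnd : M.Nodup := Finset.nodup_toList _
    refine (hMnd.filter _).append (hMnd.filter _) fun X h₂ h₁ => ?_
    exact ((hN₂ X).1 h₂).2 ((hN₁ X).1 h₁).2
  have hNdisj : (N₂ ++ N₁).Pairwise fun X Y => Disjoint X.verts Y.verts := by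
    refine List.Pairwise.imp_of_mem (fun hX hY hne => ?_) hNnd
    refine Set.disjoint_left.2 fun w hwX hwY => hne ?_
    exact ((hN _).1 hX).eq_of_mem ((hN _).1 hY) hwX hwY
  let A := RepTree.attach (N₁.map f) (.leaf v)
  have hT' : RepTree.attach (N₂.map f) A = RepTree.attach ((N₂ ++ N₁).map f) (.leaf v) := by
    simp [A, RepTree.attach]
  set T' := RepTree.attach ((N₂ ++ N₁).map f) (.leaf v) with hTdef
  have hnode : ∀ X, IsComponent G H X → RepTree.IsNode (f X) T' := fun X hX =>
    RepTree.isNode_attach_of_mem _ (List.mem_map_of_mem ((hN X).2 hX))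
  have hmemT' : ∀ u, u ∈ T'.leaves ↔ u = v ∨ ∃ X, IsComponent G H X ∧ u ∈ (f X).leaves := by
    intro u
    simp only [hTdef, RepTree.mem_leaves_attach, RepTree.leaves, List.mem_singleton,
      List.mem_map, hN]
    grind
  have hcover : ∀ u ∈ Shat G S d, ∃ X, IsComponent G H X ∧ Gv G u ≤ X := fun u hu =>
    Subgraph.exists_isComponent_ge (connected_Gv G u) (Gv_le_Hsub hu)
  refine ⟨T', ?_, ?_, ?_, ?_⟩
  · refine RepTree.nodup_leaves_attach (by simp [RepTree.leaves]) ?_ ?_ ?_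
    · simp only [List.forall_mem_map, hN]
      exact fun X hX => hTnd.sublist (hf X hX).1.leaves_sublist
    · simp only [List.forall_mem_map, hN, RepTree.leaves, List.disjoint_singleton]
      exact fun X hX hv => hvS (List.mem_toFinset.1 (hfS X hX v hv))
    · refine List.pairwise_map.2 (hNdisj.imp_of_mem fun hX hY hXY u huX huY => ?_)
      exact Set.disjoint_left.1 hXY ((hle _ ((hN _).1 hX) u huX).1 (hself u))
        ((hle _ ((hN _).1 hY) u huY).1 (hself u))
  · ext u
    rw [List.mem_toFinset, hmemT', Finset.mem_insert]
    refine or_congr_right ⟨?_, fun hu => ?_⟩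
    · rintro ⟨X, hX, hu⟩
      exact hShat u (hfS X hX u hu) (hX.2.1.1 ((hle X hX u hu).1 (hself u)))
    · obtain ⟨X, hX, huX⟩ := hcover u hu
      exact ⟨X, hX, hleaf X hX u (mem_Shat.1 hu).1 (huX.1 (hself u))⟩
  · refine RepTree.isRep_attach trivial ?_ ?_ ?_
    · simp only [List.forall_mem_map, hN]
      exact fun X hX => (hf X hX).1.isRep hTrep
    · simp only [List.forall_mem_map, hN]
      intro X hX
      rw [(hf X hX).2]
      exact (Set.ncard_le_ncard (Set.inter_subset_inter_left _ hX.2.1.1)).trans hcompat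
    · refine List.pairwise_map.2 (hNdisj.imp_of_mem fun hX hY hXY => ?_)
      rwa [(hf _ ((hN _).1 hX)).2, (hf _ ((hN _).1 hY)).2]
  · intro i hi4 hi9 X hX
    rcases lt_or_ge i d with hid | hdi
    · have hXi : IsComponent G (Hsub G S i) X := by
        rwa [Hsub, Shat_insert_Shat_of_lt hid] at hX
      obtain ⟨x, hxT, rfl⟩ := hTnode i hi4 hi9 X hXi
      obtain ⟨C, hC, hXC⟩ := Subgraph.exists_isComponent_ge hXi.1
        (hXi.2.1.trans (Hsub_mono hid.le))
      obtain ⟨u, hu⟩ := x.exists_mem_leaves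
      have huC : u ∈ (f C).leaves := hleaf C hC u
        (List.mem_toFinset.2 (hxT.leaves_sublist.subset hu))
        (hXC.1 ((RepTree.le_graphOf hu).1 (hself u)))
      rcases hxT.comparable hTnd (hf C hC).1 hu huC with h | h
      · exact ⟨x, h.trans (hnode C hC), rfl⟩
      · refine ⟨f C, hnode C hC, le_antisymm h.graphOf_le ?_⟩
        rwa [(hf C hC).2]
    · rw [Hsub, Shat_insert_Shat_of_le hv4 hdi] at hX
      let Y := RepTree.graphOf G (Gv G) A
      have hmemY : ∀ w, w ∈ Y.verts ↔ w ∈ (Gv G v).verts ∨ ∃ X ∈ N₁, w ∈ X.verts := by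
        intro w
        simp only [Y, A, RepTree.mem_verts_graphOf_attach, RepTree.graphOf,
          List.mem_map, exists_exists_and_eq_and]
        refine or_congr_right (exists_congr fun X => and_congr_right fun hX => ?_)
        rw [(hf X ((hN₁ X).1 hX).1).2]
      have hYconn : Y.Connected := by
        refine RepTree.connected_graphOf_attach (connected_Gv G v) ?_ ?_ <;>
          simp only [List.forall_mem_map, hN₁] <;> rintro X ⟨hX, hP⟩ <;> rw [(hf X hX).2]
        exacts [hX.1, hP]
      have hYdisj : ∀ X ∈ N₂, ∀ w, w ∈ X.verts → w ∉ Y.verts := by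
        intro X hX w hwX hwY
        obtain ⟨hX, hP⟩ := (hN₂ X).1 hX
        rcases (hmemY w).1 hwY with hw | ⟨Z, hZ, hwZ⟩
        · exact hP ⟨w, hwX, hw⟩
        · obtain ⟨hZ, hPZ⟩ := (hN₁ Z).1 hZ
          exact hP (hX.eq_of_mem hZ hwX hwZ ▸ hPZ)
      have hsup : ⨆ u ∈ insert v (Shat G S d), Gv G u = sSup (insert Y {X | X ∈ N₂}) := by
        rw [Finset.iSup_insert, sSup_insert]
        apply le_antisymm
        · refine sup_le (le_sup_of_le_left 
            (RepTree.isNode_attach (N₁.map f) (.leaf v)).graphOf_le) ?_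
          refine iSup₂_le fun u hu => ?_
          obtain ⟨X, hX, huX⟩ := hcover u hu
          refine huX.trans ?_
          by_cases hP : P X
          · refine le_sup_of_le_left ((hf X hX).2.symm.trans_le ?_)
            exact (RepTree.isNode_attach_of_mem _
              (List.mem_map_of_mem ((hN₁ X).2 ⟨hX, hP⟩))).graphOf_le
          · exact le_sup_of_le_right (le_sSup ((hN₂ X).2 ⟨hX, hP⟩))
        · refine sup_le ?_ (sSup_le fun X hX => le_sup_of_le_right ((hN₂ X).1 hX).1.2.1)
          simp only [Y, RepTree.graphOf_eq_iSup]
          refine iSup₂_le fun u hu => ?_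
          simp only [A, RepTree.mem_leaves_attach, RepTree.leaves, List.mem_singleton,
            List.mem_map, exists_exists_and_eq_and] at hu
          rcases hu with rfl | ⟨X, hX, hu⟩
          · exact le_sup_left
          · have hX := ((hN₁ X).1 hX).1
            exact le_sup_of_le_right ((hle X hX u hu).trans hX.2.1)
      rw [hsup] at hX
      have hXmem := Subgraph.mem_of_isComponent_sSup ?_ ?_ hX
      · rcases hXmem with rfl | hXmem
        · refine ⟨A, ?_, rfl⟩
          rw [← hT']
          exact RepTree.isNode_attach _ _
        · have hX := ((hN₂ X).1 hXmem).1
          exact ⟨f X, hnode X hX, (hf X hX).2⟩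
      · rintro X (rfl | hX)
        exacts [hYconn, ((hN₂ X).1 hX).1.1]
      · rintro X (rfl | hX) Z (rfl | hZ) w hwX hwZ
        · rfl
        · exact absurd hwX (hYdisj Z hZ w hwZ)
        · exact absurd hwZ (hYdisj X hX w hwX)
        · exact ((hN₂ X).1 hX).1.eq_of_mem ((hN₂ Z).1 hZ).1 hwX hwZ

/-- The claim in the paper that every vertex of the set `Z` has degree at least
`10`: if `G` has minimum degree at least `4` and `S` is a `φ`-maximum good
independent set with all degrees at most `9`, then every vertex outside
`S ∪ N_G(S)` of degree at most `9` has at least three neighbours in `N_G(S)`;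
consequently, every vertex outside `S ∪ N_G(S)` with at most two neighbours in
`N_G(S)` has degree at least `10`. -/
theorem Z_degree_ten (G : SimpleGraph V) [DecidableRel G.Adj]
    (hmin : ∀ w : V, 4 ≤ G.degree w)
    (S : Finset V)
    (hindep : ∀ u ∈ S, ∀ w ∈ S, ¬ G.Adj u w)
    (hdeg : ∀ w ∈ S, G.degree w ≤ 9)
    (hgood : IsGood G S)
    (hmax : ∀ S' : Finset V, (∀ u ∈ S', ∀ w ∈ S', ¬ G.Adj u w) →
      (∀ w ∈ S', G.degree w ≤ 9) → IsGood G S' → PhiGE (phi G S) (phi G S')) :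
    (∀ v : V, v ∉ S → v ∉ S.biUnion (fun u => G.neighborFinset u) →
      G.degree v ≤ 9 →
      3 ≤ (G.neighborFinset v ∩ S.biUnion (fun u => G.neighborFinset u)).card) ∧
    (∀ v : V, v ∉ S → v ∉ S.biUnion (fun u => G.neighborFinset u) →
      (G.neighborFinset v ∩ S.biUnion (fun u => G.neighborFinset u)).card ≤ 2 →
      10 ≤ G.degree v) := by
  have hfirst : ∀ v : V, v ∉ S → v ∉ S.biUnion (fun u => G.neighborFinset u) →
      G.degree v ≤ 9 →
      3 ≤ (G.neighborFinset v ∩ S.biUnion (fun u => G.neighborFinset u)).card := by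
    intro v hvS hvN hv9
    by_contra! hlt
    have hvadj : ∀ u ∈ S, ¬ G.Adj u v := by simpa using hvN
    have hsub : (Hsub G S (G.degree v)).verts ∩ (Gv G v).verts ⊆
        ((G.neighborFinset v ∩ S.biUnion (fun u => G.neighborFinset u) : Finset V) : Set V) := by
      rintro w ⟨hwH, hwv⟩
      obtain ⟨u, hu, hwu⟩ := mem_verts_Hsub.1 hwH
      replace hu := (mem_Shat.1 hu).1
      rw [mem_verts_Gv] at hwu hwv
      have hwv : G.Adj v w := by
        refine hwv.resolve_left ?_
        rintro rfl
        exact hwu.elim (fun h => hvS (h ▸ hu)) (hvadj u hu)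
      have hwu : G.Adj u w := by
        refine hwu.resolve_left ?_
        rintro rfl
        exact hvadj w hu hwv.symm
      simp only [Finset.coe_inter, Set.mem_inter_iff, Finset.mem_coe, mem_neighborFinset,
        Finset.mem_biUnion]
      exact ⟨hwv, u, hu, hwu⟩
    have hcompat : Compatible G (Hsub G S (G.degree v)) (Gv G v) := by
      have := Set.ncard_le_ncard hsub
      rw [Set.ncard_coe_finset] at this
      exact this.trans (by omega)
    refine (phi_insert_Shat hvS (hmin v) hv9).not_phiGE (hmax _ ?_ ?_
      (hgood.insert_Shat hindep hvS (hmin v) hv9 hcompat))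
    · intro u hu w hw
      simp only [Finset.mem_insert, mem_Shat] at hu hw
      rcases hu with rfl | hu <;> rcases hw with rfl | hw
      · exact G.loopless.irrefl _
      · exact fun h => hvadj w hw.1 h.symm
      · exact hvadj u hu.1
      · exact hindep u hu.1 w hw.1
    · intro w hw
      simp only [Finset.mem_insert, mem_Shat] at hw
      rcases hw with rfl | hw
      exacts [hv9, hdeg w hw.1]
  refine ⟨hfirst, fun v hvS hvN hle => ?_⟩
  by_contra! hlt
  have := hfirst v hvS hvN (by omega)
  omega
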